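/- arXiv:2206.09648 — 2 statements merged into one kernel-verified Lean document; each statement's English description precedes it below -/
import Mathlib

section
/- Let d ≥ 2 be an integer. There exists a constant c_d > 0, depending only on d, such that for every ε with 0 < ε < (8d)^{−2} the following holds. Let ρ = ⌈1/(8d·√ε)⌉, and let S = S₀ ∪ S₁ where S₀ = (ρ^{−1}·ℤ^d) ∩ ([0,1]^{d−1} × {0}) and S₁ = (ρ^{−1}·ℤ^d) ∩ ([0,1]^{d−1} × {1}). Then every Euclidean Steiner (1+ε)-spanner N = (V, E) for S has total weight ∑_{{u,v} ∈ E} ‖u − v‖ ≥ c_d · ε^{−d/2} · mst(S); that is, the lightness of N is at least c_d · ε^{−d/2}. -/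
open scoped RealInnerProductSpace

noncomputable section

/-- The Euclidean length of an (unordered) edge. -/
noncomputable def edgeLen {d : ℕ} (e : Sym2 (EuclideanSpace ℝ (Fin d))) : ℝ :=
  Sym2.lift ⟨fun a b => ‖a - b‖, fun a b => norm_sub_rev a b⟩ e

/-- The grid `(ρ⁻¹·ℤ^d) ∩ ([0,1]^{d-1} × {c})`. -/
def gridSet (d : ℕ) (ρ : ℕ) (c : ℝ) : Set (EuclideanSpace ℝ (Fin d)) :=
  {p | ∀ i : Fin d, (∃ z : ℤ, p i = (z : ℝ) / (ρ : ℝ)) ∧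
      ((i : ℕ) < d - 1 → 0 ≤ p i ∧ p i ≤ 1) ∧ ((i : ℕ) = d - 1 → p i = c)}

/-- `N = (V, E)` is a Euclidean Steiner `(1+ε)`-spanner for `S`. -/
def IsSteinerSpanner {d : ℕ} (ε : ℝ) (S : Set (EuclideanSpace ℝ (Fin d)))
    (V : Finset (EuclideanSpace ℝ (Fin d)))
    (E : Finset (Sym2 (EuclideanSpace ℝ (Fin d)))) : Prop :=
  S ⊆ ↑V ∧
  (∀ e ∈ E, ¬ e.IsDiag ∧ ∀ p ∈ e, p ∈ V) ∧
  ∀ a ∈ S, ∀ b ∈ S, ∃ (m : ℕ) (v : ℕ → EuclideanSpace ℝ (Fin d)),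
    v 0 = a ∧ v m = b ∧ (∀ i < m, s(v i, v (i + 1)) ∈ E) ∧
    ∑ i ∈ Finset.range m, ‖v (i + 1) - v i‖ ≤ (1 + ε) * ‖a - b‖

/-- The set of weights of trees with vertex set `S`: finite edge sets `T` of unordered
pairs of distinct points of `S` forming a connected graph on `S` with `|S| - 1` edges. -/
def treeWeights {d : ℕ} (S : Set (EuclideanSpace ℝ (Fin d))) : Set ℝ :=
  {w | ∃ T : Finset (Sym2 (EuclideanSpace ℝ (Fin d))),
    (∀ e ∈ T, ¬ e.IsDiag ∧ ∀ p ∈ e, p ∈ S) ∧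
    (∀ a ∈ S, ∀ b ∈ S, ∃ (m : ℕ) (v : ℕ → EuclideanSpace ℝ (Fin d)),
      v 0 = a ∧ v m = b ∧ ∀ i < m, s(v i, v (i + 1)) ∈ T) ∧
    T.card + 1 = S.ncard ∧
    w = ∑ e ∈ T, edgeLen e}

/-- The weight of a minimum spanning tree of `S`. -/
def mst {d : ℕ} (S : Set (EuclideanSpace ℝ (Fin d))) : ℝ :=
  sInf (treeWeights S)

/-- The darts of a walk contain a set of darts, each used once, with the same net displacement. -/
lemma exists_dart_subset_sum_eq {H : Type*} [AddCommGroup H] [DecidableEq H] (v : ℕ → H) (m : ℕ) :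
    ∃ F ⊆ (Finset.range m).image (fun i => (v i, v (i + 1))),
      ∑ p ∈ F, (p.2 - p.1) = v m - v 0 := by
  induction m using Nat.strong_induction_on with
  | _ m ih =>
    rcases m with _ | m
    · exact ⟨∅, by simp, by simp⟩
    by_cases h : ∃ i ≤ m, v i = v (m + 1)
    · obtain ⟨i, him, hi⟩ := h
      obtain ⟨F, hF, hs⟩ := ih i (by omega)
      refine ⟨F, hF.trans (Finset.image_subset_image ?_), by rw [hs, hi]⟩
      exact Finset.range_subset_range.2 (by omega)
    · push Not at h
      obtain ⟨F, hF, hs⟩ := ih m (by omega)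
      have hnot : (v m, v (m + 1)) ∉ F := by
        intro hmem
        obtain ⟨i, hi, heq⟩ := Finset.mem_image.1 (hF hmem)
        have := Finset.mem_range.1 hi
        exact h (i + 1) (by omega) (Prod.ext_iff.1 heq).2
      refine ⟨insert (v m, v (m + 1)) F, Finset.insert_subset ?_ (hF.trans ?_), ?_⟩
      · exact Finset.mem_image_of_mem _ (Finset.self_mem_range_succ m)
      · exact Finset.image_subset_image (Finset.range_subset_range.2 (by omega))
      · rw [Finset.sum_insert hnot, hs]
        abel

/-- Every point of a polygonal path lies in the ellipsoid defined by the length of the path. -/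
lemma norm_sub_add_norm_sub_le_path {H : Type*} [SeminormedAddCommGroup H] (v : ℕ → H)
    {i m : ℕ} (him : i ≤ m) :
    ‖v i - v 0‖ + ‖v m - v i‖ ≤ ∑ k ∈ Finset.range m, ‖v (k + 1) - v k‖ := by
  have h0 := dist_le_range_sum_dist v i
  have h1 := dist_le_Ico_sum_dist v him
  have h2 := Finset.sum_range_add_sum_Ico (fun k => ‖v (k + 1) - v k‖) him
  simp only [dist_eq_norm, norm_sub_rev (v _) (v (_ + 1))] at h0 h1
  rw [norm_sub_rev] at h0 h1
  linarith

section InnerProduct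

variable {H : Type*} [NormedAddCommGroup H] [InnerProductSpace ℝ H]

lemma norm_smul_sub_smul_sq (w P : H) :
    ‖‖P‖ • w - ‖w‖ • P‖ ^ 2 = 2 * (‖P‖ * ‖w‖) * (‖P‖ * ‖w‖ - ⟪w, P⟫) := by
  rw [norm_sub_sq_real, norm_smul, norm_smul, inner_smul_left, inner_smul_right]
  simp
  ring

lemma norm_smul_sub_smul_le_of_aligned {w P : H} {s : ℝ} (hs : 0 ≤ s)
    (h : ‖P‖ * ‖w‖ - ⟪w, P⟫ ≤ 2 * s ^ 2 * (‖P‖ * ‖w‖)) :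
    ‖‖P‖ • w - ‖w‖ • P‖ ≤ 2 * s * (‖P‖ * ‖w‖) := by
  refine le_of_sq_le_sq ?_ (by positivity)
  rw [norm_smul_sub_smul_sq]
  calc _ ≤ 2 * (‖P‖ * ‖w‖) * (2 * s ^ 2 * (‖P‖ * ‖w‖)) := by gcongr
    _ = _ := by ring

lemma norm_smul_sub_smul_le_of_ellipsoid {x P : H} {s : ℝ} (hs : 0 ≤ s) (hs1 : s ≤ 1)
    (h : ‖x‖ + ‖P - x‖ ≤ (1 + s ^ 2) * ‖P‖) :
    ‖‖P‖ • x - ‖x‖ • P‖ ≤ 2 * s * ‖P‖ ^ 2 := by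
  refine le_of_sq_le_sq ?_ (by positivity)
  rw [norm_smul_sub_smul_sq]
  have hP := norm_nonneg P
  have h1 : ⟪P - x, P⟫ ≤ ‖P - x‖ * ‖P‖ := real_inner_le_norm _ _
  rw [inner_sub_left, real_inner_self_eq_norm_sq] at h1
  have h2 : ‖P‖ * ‖x‖ - ⟪x, P⟫ ≤ s ^ 2 * ‖P‖ ^ 2 := by nlinarith
  have h3 : ‖x‖ ≤ 2 * ‖P‖ := by
    have := norm_nonneg (P - x)
    have : s ^ 2 * ‖P‖ ≤ 1 * ‖P‖ := by
      gcongr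
      exact pow_le_one₀ hs hs1
    linarith
  calc _ ≤ 2 * (‖P‖ * ‖x‖) * (s ^ 2 * ‖P‖ ^ 2) := by gcongr
    _ ≤ 2 * (‖P‖ * (2 * ‖P‖)) * (s ^ 2 * ‖P‖ ^ 2) := by gcongr
    _ = _ := by ring

/-- In a short connection, darts nearly parallel to the displacement carry half of its length. -/
lemma half_norm_le_sum_aligned {ι : Type*} (F : Finset ι) (w : ι → H) {P : H} {ε : ℝ}
    (hε : 0 < ε) (hP : 0 < ‖P‖) (hsum : ∑ i ∈ F, w i = P)
    (hlen : ∑ i ∈ F, ‖w i‖ ≤ (1 + ε) * ‖P‖) :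
    ‖P‖ / 2 ≤ ∑ i ∈ F with ‖P‖ * ‖w i‖ - ⟪w i, P⟫ ≤ 2 * ε * (‖P‖ * ‖w i‖), ‖w i‖ := by
  have hinner : ∑ i ∈ F, ⟪w i, P⟫ = ‖P‖ ^ 2 := by
    rw [← sum_inner, hsum, real_inner_self_eq_norm_sq]
  have hnorm : ‖P‖ ≤ ∑ i ∈ F, ‖w i‖ := by
    rw [← hsum]
    exact norm_sum_le _ _
  have key : ∑ i ∈ F, 2 * ε * (‖P‖ * ‖w i‖) ≤
      ∑ i ∈ F, ((‖P‖ * ‖w i‖ - ⟪w i, P⟫) +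
        if ‖P‖ * ‖w i‖ - ⟪w i, P⟫ ≤ 2 * ε * (‖P‖ * ‖w i‖) then 2 * ε * (‖P‖ * ‖w i‖) else 0) := by
    refine Finset.sum_le_sum fun i _ => ?_
    have := real_inner_le_norm (w i) P
    split_ifs <;> nlinarith
  rw [Finset.sum_add_distrib, ← Finset.sum_filter, Finset.sum_sub_distrib, hinner,
    ← Finset.mul_sum, ← Finset.mul_sum, ← Finset.mul_sum, ← Finset.mul_sum] at key
  set A := ∑ i ∈ F, ‖w i‖
  set B := ∑ i ∈ F with ‖P‖ * ‖w i‖ - ⟪w i, P⟫ ≤ 2 * ε * (‖P‖ * ‖w i‖), ‖w i‖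
  have h1 : ‖P‖ * A - ‖P‖ ^ 2 ≤ ε * ‖P‖ ^ 2 := by nlinarith
  have h2 : ε * ‖P‖ * ‖P‖ ≤ ε * ‖P‖ * A := by gcongr
  have h3 : ε * ‖P‖ * ‖P‖ ≤ ε * ‖P‖ * (2 * B) := by linarith
  have := le_of_mul_le_mul_left h3 (by positivity)
  linarith

end InnerProduct

lemma abs_apply_le_norm {ι : Type*} [Fintype ι] (x : EuclideanSpace ℝ ι) (i : ι) :
    |x i| ≤ ‖x‖ := by
  simpa using PiLp.norm_apply_le x i

section Coordinates

variable {n : ℕ}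

lemma abs_apply_div_sub_le_of_aligned {w P : EuclideanSpace ℝ (Fin (n + 1))} {s : ℝ} (hs : 0 ≤ s)
    (hw : 0 < ‖w‖) (hP : 0 < ‖P‖)
    (h : ‖P‖ * ‖w‖ - ⟪w, P⟫ ≤ 2 * s ^ 2 * (‖P‖ * ‖w‖)) (j : Fin (n + 1)) :
    |w j / ‖w‖ - P j / ‖P‖| ≤ 2 * s := by
  have h1 := (abs_apply_le_norm _ j).trans (norm_smul_sub_smul_le_of_aligned hs h)
  have h2 : w j / ‖w‖ - P j / ‖P‖ = (‖P‖ • w - ‖w‖ • P) j / (‖P‖ * ‖w‖) := by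
    simp
    field_simp
  rw [h2, abs_div, abs_of_pos (by positivity : 0 < ‖P‖ * ‖w‖)]
  exact (div_le_iff₀ (by positivity)).2 h1

/-- Two displacements of unit height that are nearly parallel to a common vector are close. -/
lemma abs_apply_sub_le_of_aligned_of_aligned {w P Q : EuclideanSpace ℝ (Fin (n + 1))} {s : ℝ}
    (hs : 0 ≤ s) (hw : 0 < ‖w‖) (hP : P (Fin.last n) = 1) (hQ : Q (Fin.last n) = 1)
    (hwP : ‖P‖ * ‖w‖ - ⟪w, P⟫ ≤ 2 * s ^ 2 * (‖P‖ * ‖w‖))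
    (hwQ : ‖Q‖ * ‖w‖ - ⟪w, Q⟫ ≤ 2 * s ^ 2 * (‖Q‖ * ‖w‖))
    (j : Fin (n + 1)) (hj : |Q j| ≤ 1) :
    |P j - Q j| ≤ 8 * s * ‖P‖ := by
  have hP0 : 0 < ‖P‖ := lt_of_lt_of_le (by simp [hP]) (abs_apply_le_norm P (Fin.last n))
  have hQ0 : 0 < ‖Q‖ := lt_of_lt_of_le (by simp [hQ]) (abs_apply_le_norm Q (Fin.last n))
  have close : ∀ i, |P i / ‖P‖ - Q i / ‖Q‖| ≤ 4 * s := fun i => by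
    have h1 := abs_le.1 (abs_apply_div_sub_le_of_aligned hs hw hP0 hwP i)
    have h2 := abs_le.1 (abs_apply_div_sub_le_of_aligned hs hw hQ0 hwQ i)
    exact abs_le.2 ⟨by linarith, by linarith⟩
  have hl := close (Fin.last n)
  rw [hP, hQ] at hl
  have hsplit : P j - Q j =
      ‖P‖ * ((P j / ‖P‖ - Q j / ‖Q‖) - Q j * (1 / ‖P‖ - 1 / ‖Q‖)) := by
    field_simp
    ring
  rw [hsplit, abs_mul, abs_norm, mul_comm]
  gcongr
  calc _ ≤ |P j / ‖P‖ - Q j / ‖Q‖| + |Q j * (1 / ‖P‖ - 1 / ‖Q‖)| := abs_sub _ _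
    _ ≤ 4 * s + 1 * (4 * s) := by
      rw [abs_mul]
      gcongr
      exact close j
    _ = 8 * s := by ring

/-- A point in the ellipsoid of a segment of unit height is close to the point of the segment
at the same height. -/
lemma abs_apply_sub_le_of_ellipsoid {a b v : EuclideanSpace ℝ (Fin (n + 1))} {s : ℝ}
    (hs : 0 ≤ s) (hs1 : s ≤ 1) (ha : a (Fin.last n) = 0) (hb : b (Fin.last n) = 1)
    (h : ‖v - a‖ + ‖b - v‖ ≤ (1 + s ^ 2) * ‖b - a‖)
    (j : Fin (n + 1)) (hj : |b j - a j| ≤ 1) :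
    |v j - a j - v (Fin.last n) * (b j - a j)| ≤ 4 * s * ‖b - a‖ := by
  have hD : 0 < ‖b - a‖ :=
    lt_of_lt_of_le (by simp [ha, hb]) (abs_apply_le_norm (b - a) (Fin.last n))
  have hE := norm_smul_sub_smul_le_of_ellipsoid (x := v - a) (P := b - a) hs hs1
    (by rwa [sub_sub_sub_cancel_right])
  have close : ∀ i, |(v i - a i) - ‖v - a‖ / ‖b - a‖ * (b i - a i)| ≤ 2 * s * ‖b - a‖ := by
    intro i
    have h1 := (abs_apply_le_norm _ i).trans hE
    have h2 : (v i - a i) - ‖v - a‖ / ‖b - a‖ * (b i - a i) =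
        (‖b - a‖ • (v - a) - ‖v - a‖ • (b - a)) i / ‖b - a‖ := by
      simp
      field_simp
    rw [h2, abs_div, abs_norm, div_le_iff₀ hD]
    linarith
  have hl := close (Fin.last n)
  have hc := close j
  rw [ha, hb] at hl
  have hsplit : v j - a j - v (Fin.last n) * (b j - a j) =
      ((v j - a j) - ‖v - a‖ / ‖b - a‖ * (b j - a j)) -
        ((v (Fin.last n) - 0) - ‖v - a‖ / ‖b - a‖ * (1 - 0)) * (b j - a j) := by ring
  rw [hsplit]
  refine (abs_sub _ _).trans ?_
  rw [abs_mul]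
  have : |v (Fin.last n) - 0 - ‖v - a‖ / ‖b - a‖ * (1 - 0)| * |b j - a j| ≤
      2 * s * ‖b - a‖ * 1 := by gcongr
  linarith

/-- The point of `ℝⁿ⁺¹` at height `c` above the point `3 x / ρ` of the coarsened grid. -/
def coarsePoint (ρ : ℕ) (c : ℝ) (x : Fin n → ℕ) : EuclideanSpace ℝ (Fin (n + 1)) :=
  WithLp.toLp 2 (Fin.snoc (α := fun _ => ℝ) (fun i => 3 * (x i : ℝ) / ρ) c)

@[simp]
lemma coarsePoint_last (ρ : ℕ) (c : ℝ) (x : Fin n → ℕ) :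
    coarsePoint ρ c x (Fin.last n) = c := by
  simp [coarsePoint]

@[simp]
lemma coarsePoint_castSucc (ρ : ℕ) (c : ℝ) (x : Fin n → ℕ) (i : Fin n) :
    coarsePoint ρ c x i.castSucc = 3 * (x i : ℝ) / ρ := by
  simp [coarsePoint]

lemma coarsePoint_mem_gridSet {ρ : ℕ} {x : Fin n → ℕ} (hx : ∀ i, 3 * x i ≤ ρ) {c : ℝ}
    (hc : ∃ z : ℤ, c = z / ρ) : coarsePoint ρ c x ∈ gridSet (n + 1) ρ c := by
  intro i
  refine Fin.lastCases ?_ (fun i => ?_) i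
  · simpa using hc
  · refine ⟨⟨3 * x i, by simp⟩, fun _ => ?_, fun h => ?_⟩
    · rw [coarsePoint_castSucc]
      have h : 3 * (x i : ℝ) ≤ ρ := by exact_mod_cast hx i
      exact ⟨by positivity, div_le_one_of_le₀ h (by positivity)⟩
    · simp at h
      omega

lemma abs_coarsePoint_sub_le {ρ : ℕ} {x y : Fin n → ℕ} (hx : ∀ i, 3 * x i ≤ ρ)
    (hy : ∀ i, 3 * y i ≤ ρ) (j : Fin (n + 1)) :
    |coarsePoint ρ 1 y j - coarsePoint ρ 0 x j| ≤ 1 := by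
  refine Fin.lastCases (by simp) (fun i => ?_) j
  rw [coarsePoint_castSucc, coarsePoint_castSucc]
  have bound : ∀ k : ℕ, 3 * k ≤ ρ → 0 ≤ 3 * (k : ℝ) / ρ ∧ 3 * (k : ℝ) / ρ ≤ 1 := fun k hk =>
    ⟨by positivity, div_le_one_of_le₀ (by exact_mod_cast hk) (by positivity)⟩
  have h1 := bound _ (hx i)
  have h2 := bound _ (hy i)
  exact abs_le.2 ⟨by linarith, by linarith⟩

lemma one_le_norm_coarsePoint_sub (ρ : ℕ) (x y : Fin n → ℕ) :
    1 ≤ ‖coarsePoint ρ 1 y - coarsePoint ρ 0 x‖ := by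
  simpa using abs_apply_le_norm (coarsePoint ρ 1 y - coarsePoint ρ 0 x) (Fin.last n)

lemma norm_coarsePoint_sub_le {ρ : ℕ} {x y : Fin n → ℕ} (hx : ∀ i, 3 * x i ≤ ρ)
    (hy : ∀ i, 3 * y i ≤ ρ) :
    ‖coarsePoint ρ 1 y - coarsePoint ρ 0 x‖ ≤ n + 1 := by
  refine le_of_sq_le_sq ?_ (by positivity)
  rw [EuclideanSpace.real_norm_sq_eq]
  calc _ ≤ ∑ _j : Fin (n + 1), (1 : ℝ) := by
        refine Finset.sum_le_sum fun j _ => ?_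
        exact (sq_le_one_iff_abs_le_one _).2 (abs_coarsePoint_sub_le hx hy j)
    _ ≤ _ := by
        simp
        nlinarith [(Nat.cast_nonneg n : (0 : ℝ) ≤ n)]

lemma eq_zero_of_abs_three_mul_div_le {ρ : ℕ} (hρ : 0 < ρ) {k : ℤ} {r t : ℝ}
    (hr : r = 3 * (k : ℝ) / ρ) (h : |r| ≤ t) (ht : t * ρ ≤ 2) : k = 0 := by
  have hρ' : (0 : ℝ) < ρ := by exact_mod_cast hρ
  rw [hr, abs_div, abs_of_pos hρ', div_le_iff₀ hρ'] at h
  have h2 : |(3 * k : ℤ)| ≤ 2 := by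
    have := h.trans ht
    exact_mod_cast this
  rw [abs_le] at h2
  omega

/-- A dart can be nearly parallel to, and on a short connection of, at most one pair of
coarsened grid points. -/
lemma coarse_pair_eq_of_common_dart {ρ : ℕ} (hρ : 0 < ρ) {s : ℝ} (hs : 0 ≤ s) (hs1 : s ≤ 1)
    (hsρ : 4 * ((n : ℝ) + 1) * s * ρ ≤ 1) {x y x' y' : Fin n → ℕ}
    (hx : ∀ i, 3 * x i ≤ ρ) (hy : ∀ i, 3 * y i ≤ ρ)
    (hx' : ∀ i, 3 * x' i ≤ ρ) (hy' : ∀ i, 3 * y' i ≤ ρ)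
    {v w : EuclideanSpace ℝ (Fin (n + 1))} (hw : 0 < ‖w‖)
    (hv : ‖v - coarsePoint ρ 0 x‖ + ‖coarsePoint ρ 1 y - v‖ ≤
      (1 + s ^ 2) * ‖coarsePoint ρ 1 y - coarsePoint ρ 0 x‖)
    (hv' : ‖v - coarsePoint ρ 0 x'‖ + ‖coarsePoint ρ 1 y' - v‖ ≤
      (1 + s ^ 2) * ‖coarsePoint ρ 1 y' - coarsePoint ρ 0 x'‖)
    (hP : ‖coarsePoint ρ 1 y - coarsePoint ρ 0 x‖ * ‖w‖ -
      ⟪w, coarsePoint ρ 1 y - coarsePoint ρ 0 x⟫ ≤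
        2 * s ^ 2 * (‖coarsePoint ρ 1 y - coarsePoint ρ 0 x‖ * ‖w‖))
    (hP' : ‖coarsePoint ρ 1 y' - coarsePoint ρ 0 x'‖ * ‖w‖ -
      ⟪w, coarsePoint ρ 1 y' - coarsePoint ρ 0 x'⟫ ≤
        2 * s ^ 2 * (‖coarsePoint ρ 1 y' - coarsePoint ρ 0 x'‖ * ‖w‖)) :
    x = x' ∧ y = y' := by
  have hD := norm_coarsePoint_sub_le hx hy
  have hD' := norm_coarsePoint_sub_le hx' hy'
  have hbound : 8 * s * ((n : ℝ) + 1) * ρ ≤ 2 := by linarith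
  have hdiff : ∀ i, ((y i : ℤ) - x i) - (y' i - x' i) = 0 := fun i => by
    refine eq_zero_of_abs_three_mul_div_le hρ ?_
      (t := 8 * s * ((n : ℝ) + 1)) ((abs_apply_sub_le_of_aligned_of_aligned hs hw
        (by simp) (by simp) hP hP' i.castSucc
        (by simpa using abs_coarsePoint_sub_le hx' hy' i.castSucc)).trans (by gcongr)) hbound
    simp
    ring
  have hxx : ∀ i, (x' i : ℤ) - x i = 0 := fun i => by
    have h1 := abs_le.1 (abs_apply_sub_le_of_ellipsoid hs hs1 (by simp) (by simp) hv i.castSucc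
      (abs_coarsePoint_sub_le hx hy _))
    have h2 := abs_le.1 (abs_apply_sub_le_of_ellipsoid hs hs1 (by simp) (by simp) hv' i.castSucc
      (abs_coarsePoint_sub_le hx' hy' _))
    have h3 : 4 * s * ‖coarsePoint ρ 1 y - coarsePoint ρ 0 x‖ ≤ 4 * s * (n + 1) := by gcongr
    have h4 : 4 * s * ‖coarsePoint ρ 1 y' - coarsePoint ρ 0 x'‖ ≤ 4 * s * (n + 1) := by gcongr
    have hslope : coarsePoint ρ 1 y' i.castSucc - coarsePoint ρ 0 x' i.castSucc =
        coarsePoint ρ 1 y i.castSucc - coarsePoint ρ 0 x i.castSucc := by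
      have : ((y i : ℝ) - x i) - (y' i - x' i) = 0 := by exact_mod_cast hdiff i
      simp only [coarsePoint_castSucc]
      rw [← sub_div, ← sub_div]
      congr 1
      linarith
    rw [hslope] at h2
    refine eq_zero_of_abs_three_mul_div_le hρ (t := 8 * s * ((n : ℝ) + 1))
      (r := coarsePoint ρ 0 x' i.castSucc - coarsePoint ρ 0 x i.castSucc) ?_
      (abs_le.2 ⟨by linarith, by linarith⟩) hbound
    simp
    ring
  constructor
  · funext i
    have := hxx i
    omega
  · funext i
    have := hxx i
    have := hdiff i
    omega

end Coordinates

lemma edgeLen_nonneg {d : ℕ} (e : Sym2 (EuclideanSpace ℝ (Fin d))) : 0 ≤ edgeLen e := by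
  induction e with
  | _ a b => exact norm_nonneg (a - b)

@[simp]
lemma edgeLen_mk {d : ℕ} (a b : EuclideanSpace ℝ (Fin d)) : edgeLen s(a, b) = ‖a - b‖ := rfl

lemma sum_darts_le_two_mul_weight {d : ℕ} (E : Finset (Sym2 (EuclideanSpace ℝ (Fin d))))
    (D : Finset (EuclideanSpace ℝ (Fin d) × EuclideanSpace ℝ (Fin d)))
    (hD : ∀ p ∈ D, s(p.1, p.2) ∈ E) :
    ∑ p ∈ D, ‖p.2 - p.1‖ ≤ 2 * ∑ e ∈ E, edgeLen e := by
  classical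
  rw [← Finset.sum_fiberwise_of_maps_to (g := fun p => s(p.1, p.2)) hD, Finset.mul_sum]
  refine Finset.sum_le_sum fun e _ => ?_
  have hcard : (D.filter fun p => s(p.1, p.2) = e).card ≤ 2 := by
    induction e with
    | _ a b =>
      refine (Finset.card_le_card (t := {(a, b), (b, a)}) fun p hp => ?_).trans Finset.card_le_two
      simpa [Prod.ext_iff] using (Finset.mem_filter.1 hp).2
  calc _ ≤ (D.filter fun p => s(p.1, p.2) = e).card • edgeLen e := by
        refine Finset.sum_le_card_nsmul _ _ _ fun p hp => ?_
        rw [← (Finset.mem_filter.1 hp).2, edgeLen_mk, norm_sub_rev]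
    _ ≤ 2 * edgeLen e := by
        rw [nsmul_eq_mul]
        have := edgeLen_nonneg e
        gcongr
        exact_mod_cast hcard

/-- A short connection yields a set of darts nearly parallel to its displacement. -/
lemma exists_aligned_darts {d : ℕ} {ε : ℝ} (hε : 0 < ε)
    {E : Finset (Sym2 (EuclideanSpace ℝ (Fin d)))} {a b : EuclideanSpace ℝ (Fin d)}
    (hab : 1 ≤ ‖b - a‖)
    (h : ∃ (m : ℕ) (v : ℕ → EuclideanSpace ℝ (Fin d)),
      v 0 = a ∧ v m = b ∧ (∀ i < m, s(v i, v (i + 1)) ∈ E) ∧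
      ∑ i ∈ Finset.range m, ‖v (i + 1) - v i‖ ≤ (1 + ε) * ‖a - b‖) :
    ∃ F : Finset (EuclideanSpace ℝ (Fin d) × EuclideanSpace ℝ (Fin d)),
      1 / 2 ≤ ∑ p ∈ F, ‖p.2 - p.1‖ ∧ ∀ p ∈ F, s(p.1, p.2) ∈ E ∧
        ‖p.1 - a‖ + ‖b - p.1‖ ≤ (1 + ε) * ‖b - a‖ ∧
        ‖b - a‖ * ‖p.2 - p.1‖ - ⟪p.2 - p.1, b - a⟫ ≤ 2 * ε * (‖b - a‖ * ‖p.2 - p.1‖) := by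
  classical
  obtain ⟨m, v, rfl, rfl, hE, hlen⟩ := h
  obtain ⟨F, hF, hsum⟩ := exists_dart_subset_sum_eq v m
  rw [norm_sub_rev (v 0)] at hlen
  have hFlen : ∑ p ∈ F, ‖p.2 - p.1‖ ≤ (1 + ε) * ‖v m - v 0‖ := by
    refine le_trans ?_ hlen
    refine (Finset.sum_le_sum_of_subset_of_nonneg hF fun _ _ _ => norm_nonneg _).trans ?_
    exact Finset.sum_image_le_of_nonneg (g := fun i => (v i, v (i + 1)))
      (f := fun p => ‖p.2 - p.1‖) fun _ _ => norm_nonneg _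
  refine ⟨_, le_trans (by linarith)
    (half_norm_le_sum_aligned F (fun p => p.2 - p.1) hε (by linarith) hsum hFlen), ?_⟩
  intro p hp
  obtain ⟨hpF, hpa⟩ := Finset.mem_filter.1 hp
  obtain ⟨i, hi, rfl⟩ := Finset.mem_image.1 (hF hpF)
  have hi' := Finset.mem_range.1 hi
  exact ⟨hE i hi', (norm_sub_add_norm_sub_le_path v hi'.le).trans hlen, hpa⟩

/-- The weight of a spanner is at least a constant times the number of pairs of coarsened grid
points. -/
lemma pow_le_weight_of_isSteinerSpanner {n ρ : ℕ} (hρ : 0 < ρ) {ε : ℝ} (hε : 0 < ε) (hε1 : ε ≤ 1)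
    (hερ : 4 * ((n : ℝ) + 1) * √ε * ρ ≤ 1) {V : Finset (EuclideanSpace ℝ (Fin (n + 1)))}
    {E : Finset (Sym2 (EuclideanSpace ℝ (Fin (n + 1))))}
    (h : IsSteinerSpanner ε (gridSet (n + 1) ρ 0 ∪ gridSet (n + 1) ρ 1) V E) :
    ((ρ : ℝ) / 3) ^ (2 * n) / 4 ≤ ∑ e ∈ E, edgeLen e := by
  classical
  obtain ⟨-, hdiag, hpath⟩ := h
  set A : Finset (Fin n → ℕ) := Fintype.piFinset fun _ => Finset.range (ρ / 3 + 1) with hA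
  have hmem : ∀ x ∈ A, ∀ i, 3 * x i ≤ ρ := fun x hx i => by
    have := Finset.mem_range.1 (Fintype.mem_piFinset.1 hx i)
    omega
  have hρ0 : (ρ : ℝ) ≠ 0 := by positivity
  have hex : ∀ q : (Fin n → ℕ) × (Fin n → ℕ), q ∈ A ×ˢ A → _ := fun q hq =>
    exists_aligned_darts hε (one_le_norm_coarsePoint_sub ρ q.1 q.2)
      (hpath _ (Or.inl (coarsePoint_mem_gridSet (hmem _ (Finset.mem_product.1 hq).1)
          ⟨0, by simp⟩))
        _ (Or.inr (coarsePoint_mem_gridSet (hmem _ (Finset.mem_product.1 hq).2)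
          ⟨ρ, by simp [hρ0]⟩)))
  choose! F hFsum hF using hex
  have hdisj : ((A ×ˢ A : Finset _) : Set _).PairwiseDisjoint F := by
    intro q hq q' hq' hne
    rw [Function.onFun, Finset.disjoint_left]
    intro p hp hp'
    apply hne
    obtain ⟨hpE, hv, hP⟩ := hF q hq p hp
    obtain ⟨-, hv', hP'⟩ := hF q' hq' p hp'
    have hpos : 0 < ‖p.2 - p.1‖ := by
      rw [norm_pos_iff, sub_ne_zero]
      intro heq
      exact (hdiag _ hpE).1 (by simp [heq])
    have hsq : √ε ^ 2 = ε := Real.sq_sqrt hε.le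
    have hq1 := Finset.mem_product.1 (Finset.mem_coe.1 hq)
    have hq2 := Finset.mem_product.1 (Finset.mem_coe.1 hq')
    rw [← hsq] at hv hv' hP hP'
    have := coarse_pair_eq_of_common_dart hρ (Real.sqrt_nonneg ε) (Real.sqrt_le_one.2 hε1) hερ
      (hmem _ hq1.1) (hmem _ hq1.2) (hmem _ hq2.1) (hmem _ hq2.2) hpos hv hv' hP hP'
    exact Prod.ext this.1 this.2
  have hdarts := sum_darts_le_two_mul_weight E ((A ×ˢ A).biUnion F) fun p hp => by
    obtain ⟨q, hq, hpq⟩ := Finset.mem_biUnion.1 hp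
    exact (hF q hq p hpq).1
  rw [Finset.sum_biUnion hdisj] at hdarts
  have hcount : ((A ×ˢ A).card : ℝ) * (1 / 2) ≤ ∑ q ∈ A ×ˢ A, ∑ p ∈ F q, ‖p.2 - p.1‖ := by
    rw [← nsmul_eq_mul]
    exact Finset.card_nsmul_le_sum _ _ _ hFsum
  have hcard : ((ρ : ℝ) / 3) ^ (2 * n) ≤ ((A ×ˢ A).card : ℝ) := by
    have h3 : (ρ : ℝ) / 3 ≤ ((ρ / 3 + 1 : ℕ) : ℝ) := by
      rw [div_le_iff₀ (by norm_num)]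
      exact_mod_cast (by omega : ρ ≤ (ρ / 3 + 1) * 3)
    have hAcard : (A ×ˢ A).card = (ρ / 3 + 1) ^ (2 * n) := by
      simp [hA, ← pow_add, two_mul]
    rw [hAcard, Nat.cast_pow]
    gcongr
  linarith

lemma exists_seq_of_reflTransGen {α : Type*} {R : α → α → Prop} {a b : α}
    (h : Relation.ReflTransGen R a b) :
    ∃ (m : ℕ) (v : ℕ → α), v 0 = a ∧ v m = b ∧ ∀ i < m, R (v i) (v (i + 1)) := by
  induction h using Relation.ReflTransGen.head_induction_on with
  | refl => exact ⟨0, fun _ => b, rfl, rfl, by simp⟩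
  | @head a c hac _ ih =>
    obtain ⟨m, v, h0, hm, hv⟩ := ih
    refine ⟨m + 1, fun k => Nat.casesOn k a v, rfl, hm, fun i hi => ?_⟩
    rcases i with _ | i
    · simpa [h0] using hac
    · exact hv i (by omega)

/-- A parent function that decreases a height function describes a spanning tree. -/
lemma sum_parent_mem_treeWeights {d : ℕ} {α : Type*} [DecidableEq α] (X : Finset α) {r : α}
    (hr : r ∈ X) (parent : α → α) (height : α → ℕ)
    (hparent : ∀ x ∈ X, x ≠ r → parent x ∈ X ∧ height (parent x) < height x)
    (f : α → EuclideanSpace ℝ (Fin d)) (hf : Function.Injective f) :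
    ∑ x ∈ X.erase r, ‖f x - f (parent x)‖ ∈ treeWeights (f '' X) := by
  classical
  have hinj : Set.InjOn (fun x => s(f x, f (parent x))) (X.erase r : Finset α) := by
    intro x hx y hy hxy
    have hx' := Finset.mem_erase.1 (Finset.mem_coe.1 hx)
    have hy' := Finset.mem_erase.1 (Finset.mem_coe.1 hy)
    rcases Sym2.eq_iff.1 hxy with h | h
    · exact hf h.1
    · have h1 := (hparent x hx'.2 hx'.1).2
      have h2 := (hparent y hy'.2 hy'.1).2
      rw [hf h.2] at h1
      rw [← hf h.1] at h2
      omega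
  set T := (X.erase r).image fun x => s(f x, f (parent x)) with hT
  have hroot : ∀ k, ∀ x ∈ X, height x = k →
      Relation.ReflTransGen (fun u v => s(u, v) ∈ T) (f x) (f r) := by
    intro k
    induction k using Nat.strong_induction_on with
    | _ k ih =>
      intro x hx hk
      by_cases hxr : x = r
      · rw [hxr]
      obtain ⟨hp, hlt⟩ := hparent x hx hxr
      refine Relation.ReflTransGen.head ?_ (ih _ (hk ▸ hlt) _ hp rfl)
      exact Finset.mem_image_of_mem _ (Finset.mem_erase.2 ⟨hxr, hx⟩)
  have hsymm : Std.Symm (fun u v : EuclideanSpace ℝ (Fin d) => s(u, v) ∈ T) :=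
    ⟨fun u v h => by rwa [Sym2.eq_swap]⟩
  refine ⟨T, ?_, ?_, ?_, ?_⟩
  · intro e he
    obtain ⟨x, hx, rfl⟩ := Finset.mem_image.1 he
    obtain ⟨hxr, hxX⟩ := Finset.mem_erase.1 hx
    obtain ⟨hp, hlt⟩ := hparent x hxX hxr
    refine ⟨fun h => ?_, fun p hp' => ?_⟩
    · rw [← hf (Sym2.mk_isDiag_iff.1 h)] at hlt
      exact lt_irrefl _ hlt
    · rcases Sym2.mem_iff.1 hp' with rfl | rfl
      · exact ⟨x, hxX, rfl⟩
      · exact ⟨_, hp, rfl⟩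
  · rintro _ ⟨x, hx, rfl⟩ _ ⟨y, hy, rfl⟩
    exact exists_seq_of_reflTransGen ((hroot _ x hx rfl).trans
      (Relation.ReflTransGen.stdSymm.symm _ _ (hroot _ y hy rfl)))
  · rw [hT, Finset.card_image_of_injOn hinj, Finset.card_erase_add_one hr,
      Set.ncard_image_of_injective _ hf, Set.ncard_coe_finset]
  · rw [hT, Finset.sum_image hinj]
    rfl

lemma mst_nonneg {d : ℕ} (S : Set (EuclideanSpace ℝ (Fin d))) : 0 ≤ mst S := by
  refine Real.sInf_nonneg ?_
  rintro _ ⟨T, -, -, -, rfl⟩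
  exact Finset.sum_nonneg fun e _ => edgeLen_nonneg e

lemma mst_le_of_mem_treeWeights {d : ℕ} {S : Set (EuclideanSpace ℝ (Fin d))} {w : ℝ}
    (hw : w ∈ treeWeights S) : mst S ≤ w := by
  refine csInf_le ⟨0, ?_⟩ hw
  rintro _ ⟨T, -, -, -, rfl⟩
  exact Finset.sum_nonneg fun e _ => edgeLen_nonneg e

section GridTree

variable {n : ℕ}

/-- The point `x / ρ` of the scaled integer grid. -/
def gridPoint (ρ : ℕ) (x : Fin (n + 1) → ℕ) : EuclideanSpace ℝ (Fin (n + 1)) :=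
  WithLp.toLp 2 fun i => (x i : ℝ) / ρ

@[simp]
lemma gridPoint_apply (ρ : ℕ) (x : Fin (n + 1) → ℕ) (i : Fin (n + 1)) :
    gridPoint ρ x i = (x i : ℝ) / ρ := rfl

lemma gridPoint_injective {ρ : ℕ} (hρ : 0 < ρ) :
    Function.Injective (gridPoint (n := n) ρ) := by
  intro x y h
  have hρ' : (ρ : ℝ) ≠ 0 := by positivity
  funext i
  have hi : gridPoint ρ x i = gridPoint ρ y i := by rw [h]
  simpa [div_left_inj' hρ'] using hi

/-- The integer coordinates of the two grids at heights `0` and `1`. -/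
def gridIndex (n ρ : ℕ) : Finset (Fin (n + 1) → ℕ) :=
  Fintype.piFinset fun i => if i = Fin.last n then {0, ρ} else Finset.range (ρ + 1)

lemma mem_gridIndex {ρ : ℕ} {x : Fin (n + 1) → ℕ} :
    x ∈ gridIndex n ρ ↔
      (x (Fin.last n) = 0 ∨ x (Fin.last n) = ρ) ∧ ∀ i ≠ Fin.last n, x i ≤ ρ := by
  rw [gridIndex, Fintype.mem_piFinset]
  constructor
  · intro h
    refine ⟨by simpa using h (Fin.last n), fun i hi => ?_⟩
    have := h i
    simp only [hi, if_false, Finset.mem_range] at this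
    omega
  · rintro ⟨hl, h⟩ i
    by_cases hi : i = Fin.last n
    · subst hi
      simpa using hl
    · simp only [hi, if_false, Finset.mem_range]
      have := h i hi
      omega

lemma card_gridIndex {ρ : ℕ} (hρ : 0 < ρ) : (gridIndex n ρ).card = 2 * (ρ + 1) ^ n := by
  rw [gridIndex, Fintype.card_piFinset, Fin.prod_univ_castSucc]
  simp [Fin.castSucc_ne_last, Finset.card_pair hρ.ne, mul_comm]

lemma gridSet_union_eq_image {ρ : ℕ} (hρ : 0 < ρ) :
    gridSet (n + 1) ρ 0 ∪ gridSet (n + 1) ρ 1 = gridPoint ρ '' (gridIndex n ρ) := by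
  have hρ' : (0 : ℝ) < ρ := by exact_mod_cast hρ
  have hlt : ∀ i : Fin (n + 1), i ≠ Fin.last n → (i : ℕ) < n := fun i hi => Fin.val_lt_last hi
  ext p
  constructor
  · intro hp
    have hnn : ∀ i, ∃ k : ℕ, p i = (k : ℝ) / ρ := by
      intro i
      have hz : (∃ z : ℤ, p i = (z : ℝ) / ρ) ∧ 0 ≤ p i := by
        rcases hp with hp | hp <;> refine ⟨(hp i).1, ?_⟩ <;> by_cases hi : i = Fin.last n
        · rw [(hp i).2.2 (by simp [hi])]
        · exact ((hp i).2.1 (by simpa using hlt i hi)).1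
        · rw [(hp i).2.2 (by simp [hi])]
          exact zero_le_one
        · exact ((hp i).2.1 (by simpa using hlt i hi)).1
      obtain ⟨⟨z, hz⟩, h0⟩ := hz
      rw [hz, le_div_iff₀ hρ', zero_mul] at h0
      have h0' : 0 ≤ z := by exact_mod_cast h0
      lift z to ℕ using h0'
      exact ⟨z, by simpa using hz⟩
    choose x hx using hnn
    refine ⟨x, mem_gridIndex.2 ⟨?_, fun i hi => ?_⟩, ?_⟩
    · have hl := hx (Fin.last n)
      rcases hp with hp | hp
      · left
        rw [(hp _).2.2 (by simp), eq_comm, div_eq_zero_iff] at hl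
        simpa [hρ.ne'] using hl
      · right
        rw [(hp _).2.2 (by simp), eq_div_iff hρ'.ne', one_mul] at hl
        exact_mod_cast hl.symm
    · have h1 : p i ≤ 1 := by
        rcases hp with hp | hp <;> exact ((hp i).2.1 (by simpa using hlt i hi)).2
      rw [hx, div_le_one hρ'] at h1
      exact_mod_cast h1
    · ext i
      rw [gridPoint_apply, hx]
  · rintro ⟨x, hx, rfl⟩
    obtain ⟨hl, hle⟩ := mem_gridIndex.1 (Finset.mem_coe.1 hx)
    have key : ∀ c : ℝ, (x (Fin.last n) : ℝ) / ρ = c → gridPoint ρ x ∈ gridSet (n + 1) ρ c := by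
      intro c hc i
      refine ⟨⟨x i, by simp⟩, fun hi => ⟨by simp; positivity, ?_⟩, fun hi => ?_⟩
      · rw [gridPoint_apply, div_le_one hρ']
        have hil : i ≠ Fin.last n := by
          rintro rfl
          simp at hi
        exact_mod_cast hle i hil
      · have : i = Fin.last n := Fin.ext (by simpa using hi)
        rw [this, gridPoint_apply, hc]
    rcases hl with hl | hl
    · exact Or.inl (key 0 (by simp [hl]))
    · exact Or.inr (key 1 (by simp [hl, hρ'.ne']))

open Classical in
/-- The parent of a grid point in a spanning tree rooted at the origin. -/
def gridParent (x : Fin (n + 1) → ℕ) : Fin (n + 1) → ℕ :=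
  if h : ∃ i, i ≠ Fin.last n ∧ x i ≠ 0 then
    Function.update x h.choose (x h.choose - 1)
  else 0

lemma gridParent_mem_and_sum_lt {ρ : ℕ} {x : Fin (n + 1) → ℕ} (hx : x ∈ gridIndex n ρ)
    (hx0 : x ≠ 0) : gridParent x ∈ gridIndex n ρ ∧ ∑ i, gridParent x i < ∑ i, x i := by
  rw [gridParent]
  split_ifs with h
  · obtain ⟨hi, hxi⟩ := h.choose_spec
    set i := h.choose
    rw [mem_gridIndex] at hx ⊢
    refine ⟨⟨?_, fun j hj => ?_⟩, Finset.sum_lt_sum (fun j _ => ?_) ⟨i, Finset.mem_univ i, ?_⟩⟩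
    · rw [Function.update_of_ne hi.symm]
      exact hx.1
    · have := hx.2 j hj
      by_cases hji : j = i
      · subst hji
        simp
        omega
      · rwa [Function.update_of_ne hji]
    · by_cases hji : j = i
      · subst hji
        simp
      · rw [Function.update_of_ne hji]
    · simp
      omega
  · refine ⟨mem_gridIndex.2 (by simp), ?_⟩
    obtain ⟨i, hi⟩ := Function.ne_iff.1 hx0
    simp only [Pi.zero_apply, Finset.sum_const_zero]
    exact Finset.sum_pos' (fun _ _ => Nat.zero_le _)
      ⟨i, Finset.mem_univ i, Nat.pos_of_ne_zero hi⟩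

lemma norm_gridPoint_sub_parent_le {ρ : ℕ} (hρ : 0 < ρ) {x : Fin (n + 1) → ℕ}
    (hx : x ∈ gridIndex n ρ) (hx0 : x ≠ 0) :
    ‖gridPoint ρ x - gridPoint ρ (gridParent x)‖ ≤
      1 / ρ + if x = Pi.single (Fin.last n) ρ then 1 else 0 := by
  have hρ' : (ρ : ℝ) ≠ 0 := by positivity
  rw [gridParent]
  split_ifs with h hs hs
  · obtain ⟨hi, hxi⟩ := h.choose_spec
    exact absurd ((congrFun hs _).trans (by rw [Pi.single_eq_of_ne hi])) hxi
  · obtain ⟨hi, hxi⟩ := h.choose_spec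
    set i := h.choose
    have : gridPoint ρ x - gridPoint ρ (Function.update x i (x i - 1)) =
        EuclideanSpace.single i (1 / (ρ : ℝ)) := by
      ext j
      by_cases hji : j = i
      · subst hji
        simp [Nat.cast_sub (Nat.one_le_iff_ne_zero.2 hxi)]
        field_simp
        ring
      · simp [hji]
    rw [this, PiLp.norm_single]
    simp
  · have : gridPoint ρ x - gridPoint ρ 0 = EuclideanSpace.single (Fin.last n) (1 : ℝ) := by
      ext j
      by_cases hj : j = Fin.last n
      · subst hj
        simp [hs, hρ']
      · simp [hs, hj]
    rw [this, PiLp.norm_single]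
    simp
  · push Not at h
    refine absurd ?_ hs
    have hlast : x (Fin.last n) = ρ := by
      refine (mem_gridIndex.1 hx).1.resolve_left fun h0 => hx0 ?_
      funext i
      by_cases hi : i = Fin.last n
      · rw [hi, h0, Pi.zero_apply]
      · exact h i hi
    funext i
    by_cases hi : i = Fin.last n
    · simp [hi, hlast]
    · rw [h i hi, Pi.single_eq_of_ne hi]

lemma mst_gridSet_le {ρ : ℕ} (hρ : 0 < ρ) (hn : 1 ≤ n) :
    mst (gridSet (n + 1) ρ 0 ∪ gridSet (n + 1) ρ 1) ≤ (2 ^ (n + 1) + 1) * (ρ : ℝ) ^ (n - 1) := by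
  classical
  have hρ1 : (1 : ℝ) ≤ ρ := by exact_mod_cast hρ
  rw [gridSet_union_eq_image hρ]
  refine (mst_le_of_mem_treeWeights (sum_parent_mem_treeWeights (gridIndex n ρ) (r := 0)
    (mem_gridIndex.2 (by simp)) gridParent (fun x => ∑ i, x i)
    (fun x hx hx0 => gridParent_mem_and_sum_lt hx hx0) _ (gridPoint_injective hρ))).trans ?_
  calc _ ≤ ∑ x ∈ (gridIndex n ρ).erase 0,
        (1 / (ρ : ℝ) + if x = Pi.single (Fin.last n) ρ then 1 else 0) := by
        refine Finset.sum_le_sum fun x hx => ?_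
        obtain ⟨hx0, hx⟩ := Finset.mem_erase.1 hx
        exact norm_gridPoint_sub_parent_le hρ hx hx0
    _ ≤ ∑ x ∈ gridIndex n ρ,
        (1 / (ρ : ℝ) + if x = Pi.single (Fin.last n) ρ then 1 else 0) := by
        refine Finset.sum_le_sum_of_subset_of_nonneg (Finset.erase_subset _ _) fun x _ _ => ?_
        positivity
    _ ≤ 2 * ((ρ : ℝ) + 1) ^ n * (1 / ρ) + 1 := by
        rw [Finset.sum_add_distrib, Finset.sum_const, card_gridIndex hρ, nsmul_eq_mul,
          Finset.sum_ite_eq']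
        push_cast
        gcongr
        split_ifs <;> norm_num
    _ ≤ 2 * (2 * (ρ : ℝ)) ^ n * (1 / ρ) + (ρ : ℝ) ^ (n - 1) := by
        gcongr
        · linarith
        · exact one_le_pow₀ hρ1
    _ = _ := by
        obtain ⟨k, rfl⟩ := Nat.exists_eq_add_of_le' hn
        simp only [Nat.add_sub_cancel]
        field_simp
        ring

end GridTree

-- **Statement 4.** For `d ≥ 2` there is `c_d > 0` such that for all `0 < ε < (8d)⁻²`,
-- every Euclidean Steiner `(1+ε)`-spanner for the two-grid set `S = S₀ ∪ S₁` has total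
-- weight at least `c_d · ε^{-d/2} · mst(S)`, i.e. its lightness is at least `c_d · ε^{-d/2}`.
theorem steiner_spanner_lightness_lower_bound (d : ℕ) (hd : 2 ≤ d) :
    ∃ c : ℝ, 0 < c ∧
      ∀ ε : ℝ, 0 < ε → ε < ((8 * (d : ℝ)) ^ 2)⁻¹ →
      ∀ (V : Finset (EuclideanSpace ℝ (Fin d)))
        (E : Finset (Sym2 (EuclideanSpace ℝ (Fin d)))),
        IsSteinerSpanner ε
          (gridSet d ⌈1 / (8 * (d : ℝ) * Real.sqrt ε)⌉₊ 0 ∪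
            gridSet d ⌈1 / (8 * (d : ℝ) * Real.sqrt ε)⌉₊ 1) V E →
        c * ε ^ (-(d : ℝ) / 2) *
            mst (gridSet d ⌈1 / (8 * (d : ℝ) * Real.sqrt ε)⌉₊ 0 ∪
              gridSet d ⌈1 / (8 * (d : ℝ) * Real.sqrt ε)⌉₊ 1) ≤
          ∑ e ∈ E, edgeLen e := by
  obtain ⟨n, rfl⟩ := Nat.exists_eq_add_of_le' (by omega : 1 ≤ d)
  have hn : 1 ≤ n := by omega
  push_cast
  set M : ℝ := 8 * ((n : ℝ) + 1) with hM
  have hM1 : 1 ≤ M := by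
    have : (0 : ℝ) ≤ n := by positivity
    linarith
  refine ⟨(M ^ (n + 1) * (2 ^ (n + 1) + 1) * (4 * 9 ^ n))⁻¹, by positivity, ?_⟩
  intro ε hε hεM V E hspan
  have hs : 0 < √ε := Real.sqrt_pos.2 hε
  have hMs : M * √ε < 1 := by
    have h1 : √ε < √((M ^ 2)⁻¹) := Real.sqrt_lt_sqrt hε.le hεM
    rw [Real.sqrt_inv, Real.sqrt_sq (by positivity)] at h1
    rwa [lt_inv_comm₀ hs (by positivity), inv_eq_one_div, lt_div_iff₀ hs] at h1
  set ρ : ℕ := ⌈1 / (M * √ε)⌉₊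
  have hρ : 0 < ρ := Nat.ceil_pos.2 (by positivity)
  have hlow : 1 ≤ M * √ε * ρ := by
    have := Nat.le_ceil (1 / (M * √ε))
    rwa [div_le_iff₀' (by positivity)] at this
  have hup : M * √ε * ρ ≤ 2 := by
    have h1 := (Nat.ceil_lt_add_one (by positivity : 0 ≤ 1 / (M * √ε))).le
    calc M * √ε * ρ ≤ M * √ε * (1 / (M * √ε) + 1) := by gcongr
      _ = 1 + M * √ε := by field_simp
      _ ≤ 2 := by linarith
  have hε1 : ε ≤ 1 :=
    hεM.le.trans (inv_le_one_of_one_le₀ (one_le_pow₀ hM1))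
  have hW := pow_le_weight_of_isSteinerSpanner hρ hε hε1 (by rw [hM] at hup; linarith) hspan
  have hmst := mst_gridSet_le hρ hn
  have hpow : ε ^ (-((n : ℝ) + 1) / 2) ≤ (M * ρ) ^ (n + 1) := by
    have h1 : ε ^ (-((n : ℝ) + 1) / 2) = ((√ε)⁻¹) ^ (n + 1) := by
      rw [Real.sqrt_eq_rpow, ← Real.rpow_neg hε.le, ← Real.rpow_natCast, ← Real.rpow_mul hε.le]
      congr 1
      push_cast
      ring
    rw [h1]
    gcongr
    rw [inv_le_iff_one_le_mul₀ hs]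
    linarith
  have hmst0 := mst_nonneg (gridSet (n + 1) ρ 0 ∪ gridSet (n + 1) ρ 1)
  clear_value M ρ
  calc _ ≤ (M ^ (n + 1) * (2 ^ (n + 1) + 1) * (4 * 9 ^ n))⁻¹ * (M * ρ) ^ (n + 1) *
        ((2 ^ (n + 1) + 1) * (ρ : ℝ) ^ (n - 1)) := by gcongr
    _ = ((ρ : ℝ) / 3) ^ (2 * n) / 4 := by
        obtain ⟨k, rfl⟩ := Nat.exists_eq_add_of_le' hn
        have h9 : (3 : ℝ) ^ (2 * (k + 1)) = 9 ^ (k + 1) := by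
          rw [pow_mul]
          norm_num
        rw [div_pow, h9, mul_pow, Nat.add_sub_cancel]
        field_simp
        ring
    _ ≤ _ := hW

end
end

section
/- There exists an absolute constant C > 0 such that for every ε ∈ (0, 1] the following holds. Let s = (0, ε^{−1/2}), and let L be a staircase path (a rectilinear polygonal path that is both x-monotone nondecreasing and y-monotone nondecreasing) contained in the vertical strip {(x, y) : −1/2 ≤ x ≤ 1/2}, whose right (top) endpoint is the point (1/2, 0). Then there exists a geometric graph E comprised of the edges of L together with additional segments of total weight at most C · ε^{−1/2}, such that for every point t ∈ L there is an st-path P in E with weight ‖P‖ ≤ (1 + C·ε)·|y(s) − y(t)| ≤ (1 + C·ε)·‖s − t‖. -/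
open scoped Classical

noncomputable section

/-- The Euclidean plane. -/
abbrev Plane : Type := EuclideanSpace ℝ (Fin 2)

/-- The point `(x, y) ∈ ℝ²`. -/
def pt (x y : ℝ) : Plane := (EuclideanSpace.equiv (Fin 2) ℝ).symm ![x, y]

/-- The union of the segments of a geometric graph. -/
def segUnion (E : Finset (Plane × Plane)) : Set Plane :=
  ⋃ e ∈ E, segment ℝ e.1 e.2

/-- The total weight of a geometric graph: the sum of the Euclidean lengths of its
segments. -/
def gweight (E : Finset (Plane × Plane)) : ℝ :=
  ∑ e ∈ E, ‖e.1 - e.2‖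

/-- `HasPath E s t w` : there is a polygonal path from `s` to `t`, each of whose edges is
contained in the union of the segments of `E`, of weight at most `w`. -/
def HasPath (E : Finset (Plane × Plane)) (s t : Plane) (w : ℝ) : Prop :=
  ∃ (m : ℕ) (v : ℕ → Plane), v 0 = s ∧ v m = t ∧
    (∀ i < m, segment ℝ (v i) (v (i + 1)) ⊆ segUnion E) ∧
    ∑ i ∈ Finset.range m, ‖v (i + 1) - v i‖ ≤ w

/-- A rectilinear path: every edge is horizontal or vertical. -/
def IsRectilinear (n : ℕ) (u : ℕ → Plane) : Prop :=
  ∀ i < n, u i 0 = u (i + 1) 0 ∨ u i 1 = u (i + 1) 1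

/-- The set of points of the polygonal path with vertices `u 0, …, u n`. -/
def pathSet (n : ℕ) (u : ℕ → Plane) : Set Plane :=
  ⋃ i ∈ Finset.range n, segment ℝ (u i) (u (i + 1))

/-- The edges of the polygonal path with vertices `u 0, …, u n`, as a geometric graph. -/
def pathEdges (n : ℕ) (u : ℕ → Plane) : Finset (Plane × Plane) :=
  (Finset.range n).image fun i => (u i, u (i + 1))

/-- A staircase path: a rectilinear path that is both `x`-monotone nondecreasing and
`y`-monotone nondecreasing. -/
def IsStaircase (n : ℕ) (u : ℕ → Plane) : Prop :=
  IsRectilinear n u ∧ ∀ i < n, u i 0 ≤ u (i + 1) 0 ∧ u i 1 ≤ u (i + 1) 1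

@[simp] lemma pt_zero (x y : ℝ) : pt x y 0 = x := rfl

@[simp] lemma pt_one (x y : ℝ) : pt x y 1 = y := rfl

lemma norm_sub_le_of_sq_le {p q : Plane} {c : ℝ} (hc : 0 ≤ c)
    (h : (p 0 - q 0) ^ 2 + (p 1 - q 1) ^ 2 ≤ c ^ 2) : ‖p - q‖ ≤ c := by
  rw [EuclideanSpace.norm_eq]
  apply Real.sqrt_le_iff.2 ⟨hc, ?_⟩
  simpa [Fin.sum_univ_two] using h

lemma norm_sub_le_abs_add_abs (p q : Plane) : ‖p - q‖ ≤ |p 0 - q 0| + |p 1 - q 1| := by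
  apply norm_sub_le_of_sq_le (by positivity)
  nlinarith [sq_abs (p 0 - q 0), sq_abs (p 1 - q 1), abs_nonneg (p 0 - q 0),
    abs_nonneg (p 1 - q 1), mul_nonneg (abs_nonneg (p 0 - q 0)) (abs_nonneg (p 1 - q 1))]

lemma norm_sub_le_of_coord_le {p q : Plane} (h0 : p 0 ≤ q 0) (h1 : p 1 ≤ q 1) :
    ‖p - q‖ ≤ (q 0 - p 0) + (q 1 - p 1) := by
  have := norm_sub_le_abs_add_abs p q
  rwa [abs_of_nonpos (by linarith), abs_of_nonpos (by linarith), neg_sub, neg_sub] at this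

/-- A segment that is steep compared to its horizontal extent is barely longer than its
vertical extent. -/
lemma norm_sub_le_of_slope {p q : Plane} {a σ : ℝ} (ha : 0 ≤ a) (hσ : 0 < σ)
    (h0 : q 0 - p 0 = a) (h1 : q 1 - p 1 = σ * a) : ‖p - q‖ ≤ (q 1 - p 1) + a / σ := by
  have h2 : 0 ≤ a / σ := by positivity
  have h3 : σ * a * (a / σ) = a ^ 2 := by field_simp
  apply norm_sub_le_of_sq_le (by rw [h1]; positivity)
  rw [show p 0 - q 0 = -a by linarith, show p 1 - q 1 = -(σ * a) by linarith, h1]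
  nlinarith

lemma coord_mem_of_mem_segment {p q t : Plane} (i : Fin 2) (hpq : p i ≤ q i)
    (ht : t ∈ segment ℝ p q) : p i ≤ t i ∧ t i ≤ q i := by
  obtain ⟨a, b, ha, hb, hab, rfl⟩ := ht
  obtain rfl : a = 1 - b := by linarith
  simp only [PiLp.add_apply, PiLp.smul_apply, smul_eq_mul]
  constructor <;> nlinarith

/-- A point of an axis-parallel line lying between `p` and `q` belongs to their segment. -/
lemma mem_segment_of_coord {p q t : Plane} {i j : Fin 2} (hij : i ≠ j) (h : p i = q i)
    (ht : t i = q i) (h1 : p j ≤ t j) (h2 : t j ≤ q j) : t ∈ segment ℝ p q := by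
  have hcase : ∀ l : Fin 2, l = i ∨ l = j := by omega
  rcases eq_or_lt_of_le (h1.trans h2) with he | hlt
  · have htp : t = p := by
      ext l
      rcases hcase l with rfl | rfl <;> linarith
    exact htp ▸ left_mem_segment ℝ p q
  · have hne : q j - p j ≠ 0 := by linarith
    refine ⟨(q j - t j) / (q j - p j), (t j - p j) / (q j - p j),
      div_nonneg (by linarith) (by linarith), div_nonneg (by linarith) (by linarith),
      by field_simp; ring, ?_⟩
    ext l
    rcases hcase l with rfl | rfl
    · simp only [PiLp.add_apply, PiLp.smul_apply, smul_eq_mul, h, ht]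
      field_simp
      ring
    · simp only [PiLp.add_apply, PiLp.smul_apply, smul_eq_mul]
      field_simp
      ring

lemma gweight_union_le (A B : Finset (Plane × Plane)) :
    gweight (A ∪ B) ≤ gweight A + gweight B := by
  unfold gweight
  rw [← Finset.sum_union_inter]
  exact le_add_of_nonneg_right (Finset.sum_nonneg fun _ _ => norm_nonneg _)

lemma gweight_singleton (p q : Plane) : gweight {(p, q)} = ‖p - q‖ := by
  simp [gweight]

lemma segment_subset_segUnion {E : Finset (Plane × Plane)} {p q : Plane} (h : (p, q) ∈ E) :
    segment ℝ p q ⊆ segUnion E :=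
  Set.subset_biUnion_of_mem (u := fun e : Plane × Plane => segment ℝ e.1 e.2) h

lemma segUnion_pathEdges (n : ℕ) (u : ℕ → Plane) : segUnion (pathEdges n u) = pathSet n u := by
  simp [segUnion, pathEdges, pathSet]

lemma segUnion_mono {E F : Finset (Plane × Plane)} (h : E ⊆ F) : segUnion E ⊆ segUnion F :=
  Set.biUnion_subset_biUnion_left h

lemma HasPath.refl (E : Finset (Plane × Plane)) (s : Plane) : HasPath E s s 0 :=
  ⟨0, fun _ => s, rfl, rfl, by simp, by simp⟩

lemma HasPath.mono {E : Finset (Plane × Plane)} {s t : Plane} {w w' : ℝ}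
    (h : HasPath E s t w) (hw : w ≤ w') : HasPath E s t w' := by
  obtain ⟨m, v, h0, hm, hs, hsum⟩ := h
  exact ⟨m, v, h0, hm, hs, hsum.trans hw⟩

lemma HasPath.snoc {E : Finset (Plane × Plane)} {s a b : Plane} {w : ℝ}
    (h : HasPath E s a w) (hab : segment ℝ b a ⊆ segUnion E) :
    HasPath E s b (w + ‖b - a‖) := by
  obtain ⟨m, v, h0, hm, hs, hsum⟩ := h
  refine ⟨m + 1, fun i => if i ≤ m then v i else b, by simpa using h0, by simp, ?_, ?_⟩
  · intro i hi
    rcases eq_or_lt_of_le (Nat.lt_succ_iff.1 hi) with rfl | hlt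
    · simpa [hm, segment_symm ℝ a b] using hab
    · simpa [hlt.le, Nat.succ_le_of_lt hlt] using hs i hlt
  · rw [Finset.sum_range_succ]
    have : ∑ i ∈ Finset.range m, ‖(if i + 1 ≤ m then v (i + 1) else b) -
        (if i ≤ m then v i else b)‖ = ∑ i ∈ Finset.range m, ‖v (i + 1) - v i‖ := by
      refine Finset.sum_congr rfl fun i hi => ?_
      have hlt := Finset.mem_range.1 hi
      rw [if_pos (Nat.succ_le_of_lt hlt), if_pos hlt.le]
    rw [this]
    simpa [hm] using hsum

/-- `Stair S p r T`: there is a staircase path from `p` up to `r` whose edges lie in `S` and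
whose set of points is `T`. -/
inductive Stair (S : Set Plane) : Plane → Plane → Set Plane → Prop
  | refl (p : Plane) : Stair S p p {p}
  | cons {p q r : Plane} {T : Set Plane} (hS : segment ℝ p q ⊆ S)
      (hrect : p 0 = q 0 ∨ p 1 = q 1) (h0 : p 0 ≤ q 0) (h1 : p 1 ≤ q 1)
      (h : Stair S q r T) : Stair S p r (segment ℝ p q ∪ T)

lemma Stair.coord_le {S : Set Plane} {p r : Plane} {T : Set Plane} (h : Stair S p r T) :
    p 0 ≤ r 0 ∧ p 1 ≤ r 1 := by
  induction h with
  | refl p => simp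
  | cons hS hrect h0 h1 h ih => exact ⟨h0.trans ih.1, h1.trans ih.2⟩

lemma Stair.coord_bounds {S : Set Plane} {p r : Plane} {T : Set Plane} (h : Stair S p r T)
    {t : Plane} (ht : t ∈ T) : p 0 ≤ t 0 ∧ t 0 ≤ r 0 ∧ t 1 ≤ r 1 := by
  induction h with
  | refl p =>
    obtain rfl := ht
    simp
  | cons hS hrect h0 h1 h ih =>
    have hle := h.coord_le
    rcases ht with ht | ht
    · have := coord_mem_of_mem_segment 0 h0 ht
      have := coord_mem_of_mem_segment 1 h1 ht
      refine ⟨?_, ?_, ?_⟩ <;> linarith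
    · have := ih ht
      exact ⟨h0.trans this.1, this.2⟩

/-- A staircase can be cut at every abscissa in its range. -/
lemma Stair.exists_cut {S : Set Plane} {p r : Plane} {T : Set Plane} (h : Stair S p r T)
    {c : ℝ} (hpc : p 0 ≤ c) (hcr : c ≤ r 0) :
    ∃ m T₁ T₂, Stair S p m T₁ ∧ Stair S m r T₂ ∧ m 0 = c ∧ T ⊆ T₁ ∪ T₂ := by
  induction h with
  | refl p =>
    exact ⟨p, {p}, {p}, .refl p, .refl p, le_antisymm hpc hcr, by simp⟩
  | @cons p q r T hS hrect h0 h1 h ih =>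
    by_cases hc : q 0 ≤ c
    · obtain ⟨m, T₁, T₂, hT₁, hT₂, hm, hsub⟩ := ih hc hcr
      refine ⟨m, segment ℝ p q ∪ T₁, T₂, .cons hS hrect h0 h1 hT₁, hT₂, hm, ?_⟩
      rw [Set.union_assoc]
      exact Set.union_subset_union_right _ hsub
    · push Not at hc
      have hy : p 1 = q 1 := hrect.resolve_left (by linarith)
      have hmem : pt c (q 1) ∈ segment ℝ p q :=
        mem_segment_of_coord one_ne_zero hy rfl hpc hc.le
      have hp := (convex_segment (𝕜 := ℝ) p q).segment_subset (left_mem_segment ℝ p q) hmem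
      have hq := (convex_segment (𝕜 := ℝ) p q).segment_subset hmem (right_mem_segment ℝ p q)
      refine ⟨pt c (q 1), segment ℝ p (pt c (q 1)) ∪ {pt c (q 1)},
        segment ℝ (pt c (q 1)) q ∪ T,
        .cons (hp.trans hS) (.inr hy) hpc hy.le (.refl _),
        .cons (hq.trans hS) (.inr rfl) hc.le le_rfl h, rfl, ?_⟩
      rintro t (ht | ht)
      · have htx := coord_mem_of_mem_segment 0 h0 ht
        have hty := coord_mem_of_mem_segment 1 h1 ht
        have ht1 : t 1 = q 1 := by linarith
        rcases le_total (t 0) c with htc | htc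
        · exact .inl (.inl (mem_segment_of_coord one_ne_zero hy ht1 htx.1 htc))
        · exact .inr (.inl (mem_segment_of_coord one_ne_zero rfl ht1 htc htx.2))
      · exact .inr (.inr ht)

/-- Following a staircase downwards costs at most the sum of its extents. -/
lemma Stair.hasPath {S : Set Plane} {p r : Plane} {T : Set Plane} (h : Stair S p r T)
    {E : Finset (Plane × Plane)} (hE : S ⊆ segUnion E) {s : Plane} {w : ℝ}
    (hs : HasPath E s r w) {t : Plane} (ht : t ∈ T) :
    HasPath E s t (w + (r 0 - t 0) + (r 1 - t 1)) := by
  suffices H : HasPath E s p (w + (r 0 - p 0) + (r 1 - p 1)) ∧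
      ∀ t ∈ T, HasPath E s t (w + (r 0 - t 0) + (r 1 - t 1)) from H.2 t ht
  clear ht
  induction h with
  | refl p =>
    have hp : HasPath E s p (w + (p 0 - p 0) + (p 1 - p 1)) := hs.mono (by linarith)
    refine ⟨hp, ?_⟩
    rintro t rfl
    exact hp
  | @cons p q r T hS hrect h0 h1 h ih =>
    obtain ⟨hq, hT⟩ := ih hs
    have hseg : ∀ t ∈ segment ℝ p q, HasPath E s t (w + (r 0 - t 0) + (r 1 - t 1)) := by
      intro t ht
      have hsub := (convex_segment (𝕜 := ℝ) p q).segment_subset ht (right_mem_segment ℝ p q)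
      refine (hq.snoc ((hsub.trans hS).trans hE)).mono ?_
      have := norm_sub_le_of_coord_le (coord_mem_of_mem_segment 0 h0 ht).2
        (coord_mem_of_mem_segment 1 h1 ht).2
      linarith
    refine ⟨hseg p (left_mem_segment ℝ p q), ?_⟩
    rintro t (ht | ht)
    · exact hseg t ht
    · exact hT t ht

/-- Above a staircase there is a path that, seen from `z`, alternates between segments of
slope `σ` and vertical parts of the staircase. -/
lemma Stair.exists_steep_path {S : Set Plane} {p r : Plane} {T : Set Plane}
    (h : Stair S p r T) {σ : ℝ} (hσ : 0 < σ) {z : Plane} (hz0 : z 0 = p 0) (hz1 : p 1 ≤ z 1) :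
    ∃ (Ex : Finset (Plane × Plane)) (z' : Plane),
      gweight Ex ≤ (1 + σ) * (r 0 - p 0) ∧ z' 0 = r 0 ∧ r 1 ≤ z' 1 ∧
      z' 1 - r 1 ≤ (z 1 - p 1) + σ * (r 0 - p 0) ∧
      ∀ E : Finset (Plane × Plane), S ⊆ segUnion E → Ex ⊆ E → ∀ s w, HasPath E s z' w →
        HasPath E s z (w + (z' 1 - z 1) + (r 0 - p 0) / σ) := by
  induction h generalizing z with
  | refl p =>
    refine ⟨∅, z, by simp [gweight], hz0, hz1, by simp, ?_⟩
    intro E _ _ s w hs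
    exact hs.mono (by simp)
  | @cons p q r T hS hrect h0 h1 h ih =>
    rcases hrect with hx | hy
    · by_cases hzq : q 1 ≤ z 1
      · obtain ⟨Ex, z', hw, hz', hr, hgap, hpath⟩ := ih (hz0.trans hx) hzq
        refine ⟨Ex, z', by rwa [hx], hz', hr, by rw [hx]; linarith, by rwa [hx]⟩
      · push Not at hzq
        obtain ⟨Ex, z', hw, hz', hr, hgap, hpath⟩ := ih (z := q) rfl le_rfl
        refine ⟨Ex, z', by rwa [hx], hz', hr, by rw [hx]; linarith, ?_⟩
        intro E hE hEx s w hs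
        have hmem := mem_segment_of_coord zero_ne_one hx (hz0.trans hx) hz1 hzq.le
        have hsub := (convex_segment (𝕜 := ℝ) p q).segment_subset hmem
          (right_mem_segment ℝ p q)
        refine ((hpath E hE hEx s w hs).snoc ((hsub.trans hS).trans hE)).mono ?_
        have := norm_sub_le_of_coord_le (hz0.trans hx).le hzq.le
        rw [hx] at hz0 ⊢
        linarith
    · set y : Plane := pt (q 0) (z 1 + σ * (q 0 - p 0))
      have ha : 0 ≤ q 0 - p 0 := by linarith
      have hσa : 0 ≤ σ * (q 0 - p 0) := by positivity
      have hy0 : y 0 = q 0 := rfl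
      have hy1 : y 1 = z 1 + σ * (q 0 - p 0) := rfl
      obtain ⟨Ex, z', hw, hz', hr, hgap, hpath⟩ := ih hy0 (by linarith)
      refine ⟨{(z, y)} ∪ Ex, z', ?_, hz', hr, by linarith, ?_⟩
      · have h2 := gweight_union_le {(z, y)} Ex
        have h3 := norm_sub_le_of_coord_le (p := z) (q := y) (by linarith) (by linarith)
        rw [gweight_singleton] at h2
        linarith
      · intro E hE hEx s w hs
        have h2 := hpath E hE (Finset.union_subset_right hEx) s w hs
        refine (h2.snoc (segment_subset_segUnion (hEx (by simp)))).mono ?_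
        have h3 := norm_sub_le_of_slope (p := z) (q := y) ha hσ (by linarith) (by linarith)
        have h4 : (r 0 - p 0) / σ = (r 0 - q 0) / σ + (q 0 - p 0) / σ := by ring
        linarith

/-- A shallow-light tree rooted at height `d` above the top of a staircase of width at most
`w`, built by bisecting the staircase `k` times. -/
lemma Stair.exists_shallow_light {S : Set Plane} (k : ℕ) {p r : Plane} {T : Set Plane}
    (h : Stair S p r T) {w d : ℝ} (hw : 0 < w) (hd : 0 < d) (hpr : r 0 - p 0 ≤ w) :
    ∃ Ex : Finset (Plane × Plane), gweight Ex ≤ 4 * d + k * (w / 2) ∧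
      ∀ E : Finset (Plane × Plane), S ⊆ segUnion E → Ex ⊆ E →
        ∀ s w₀, HasPath E s (pt (r 0) (r 1 + d)) w₀ → ∀ t ∈ T,
          HasPath E s t (w₀ + (r 1 + d - t 1) + 3 * w ^ 2 / d + w / 2 ^ k) := by
  induction k generalizing p r T w d with
  | zero =>
    have hnorm := norm_sub_le_of_coord_le (p := r) (q := pt (r 0) (r 1 + d)) le_rfl
      (by simpa using hd.le)
    simp only [pt_zero, pt_one] at hnorm
    refine ⟨{(r, pt (r 0) (r 1 + d))}, ?_, ?_⟩
    · rw [gweight_singleton]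
      push_cast
      linarith
    · intro E hE hEx s w₀ hs t ht
      have h2 := hs.snoc (segment_subset_segUnion (hEx (Finset.mem_singleton_self _)))
      refine (h.hasPath hE h2 ht).mono ?_
      have h3 : 0 ≤ 3 * w ^ 2 / d := by positivity
      have h4 := (h.coord_bounds ht).1
      rw [pow_zero, div_one]
      linarith
  | succ k ih =>
    have hle := h.coord_le
    obtain ⟨m, T₁, T₂, hT₁, hT₂, hm, hT⟩ :=
      h.exists_cut (c := (p 0 + r 0) / 2) (by linarith) (by linarith)
    obtain ⟨E₁, hwt₁, hpath₁⟩ := ih hT₁ (half_pos hw) (show 0 < d / 3 by positivity)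
      (by linarith)
    obtain ⟨E₂, hwt₂, hpath₂⟩ := ih hT₂ (half_pos hw) (show 0 < d / 3 by positivity)
      (by linarith)
    have hσ : 0 < 2 * d / (3 * w) := by positivity
    have hσw : 2 * d / (3 * w) * (w / 2) = d / 3 := by field_simp
    have hwσ : w / 2 / (2 * d / (3 * w)) = 3 * w ^ 2 / d / 4 := by field_simp; norm_num
    set σ : ℝ := 2 * d / (3 * w)
    have hmw : r 0 - m 0 ≤ w / 2 := by linarith
    have hσm : σ * (r 0 - m 0) ≤ d / 3 := hσw ▸ mul_le_mul_of_nonneg_left hmw hσ.le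
    have hmσ : (r 0 - m 0) / σ ≤ 3 * w ^ 2 / d / 4 :=
      hwσ ▸ div_le_div_of_nonneg_right hmw hσ.le
    obtain ⟨E₃, z, hwt₃, hz0, hz1, hgap, hpath₃⟩ :=
      hT₂.exists_steep_path hσ (z := pt (m 0) (m 1 + d / 3)) rfl (by simp; positivity)
    simp only [pt_one] at hgap hpath₃
    set top : Plane := pt (r 0) (r 1 + d)
    have htop0 : top 0 = r 0 := rfl
    have htop1 : top 1 = r 1 + d := rfl
    have hshrink : 3 * (w / 2) ^ 2 / (d / 3) = 3 * (3 * w ^ 2 / d) / 4 := by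
      field_simp; norm_num
    have hhalf : w / 2 / 2 ^ k = w / 2 ^ (k + 1) := by
      rw [pow_succ]; field_simp
    have hexc : 0 ≤ 3 * w ^ 2 / d := by positivity
    refine ⟨{(r, top)} ∪ (E₁ ∪ (E₂ ∪ E₃)), ?_, ?_⟩
    · have h1 := gweight_union_le {(r, top)} (E₁ ∪ (E₂ ∪ E₃))
      have h2 := gweight_union_le E₁ (E₂ ∪ E₃)
      have h3 := gweight_union_le E₂ E₃
      have h4 := norm_sub_le_of_coord_le (p := r) (q := top) le_rfl (by linarith)
      rw [gweight_singleton] at h1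
      push_cast
      linarith
    · intro E hE hEx s w₀ hs t ht
      obtain ⟨hE₀, hEx⟩ := Finset.union_subset_iff.1 hEx
      obtain ⟨hE₁, hEx⟩ := Finset.union_subset_iff.1 hEx
      obtain ⟨hE₂, hE₃⟩ := Finset.union_subset_iff.1 hEx
      have hspur : ∀ z : Plane, z 0 = r 0 → r 1 ≤ z 1 → z 1 ≤ r 1 + d →
          HasPath E s z (w₀ + (r 1 + d - z 1)) := by
        intro z h0 h1 h2
        have hmem := mem_segment_of_coord (p := r) (q := top) zero_ne_one rfl h0 h1 h2
        have hsub := (convex_segment (𝕜 := ℝ) r top).segment_subset hmem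
          (right_mem_segment ℝ r top)
        refine (hs.snoc (hsub.trans
          (segment_subset_segUnion (hE₀ (Finset.mem_singleton_self _))))).mono ?_
        have := norm_sub_le_of_coord_le (p := z) (q := top) (by linarith) (by linarith)
        linarith
      rcases hT ht with ht | ht
      · have hz := hspur z hz0 hz1 (by linarith)
        have hzm := hpath₃ E hE hE₃ s _ hz
        refine (hpath₁ E hE hE₁ s _ hzm t ht).mono ?_
        linarith
      · have hz := hspur (pt (r 0) (r 1 + d / 3)) rfl (by simp; positivity)
          (by simp only [pt_one]; linarith)
        refine (hpath₂ E hE hE₂ s _ hz t ht).mono ?_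
        simp only [pt_one]
        linarith

lemma IsStaircase.exists_stair {n : ℕ} {u : ℕ → Plane} (h : IsStaircase n u) :
    ∃ T, Stair (pathSet n u) (u 0) (u n) T ∧ pathSet n u ⊆ T := by
  have hseg : ∀ i < n, segment ℝ (u i) (u (i + 1)) ⊆ pathSet n u := fun i hi =>
    Set.subset_biUnion_of_mem (u := fun i => segment ℝ (u i) (u (i + 1)))
      (Finset.mem_range.2 hi)
  have key : ∀ j ≤ n, ∃ T, Stair (pathSet n u) (u j) (u n) T ∧
      ∀ i, j ≤ i → i < n → segment ℝ (u i) (u (i + 1)) ⊆ T := by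
    intro j hj
    induction hj using Nat.decreasingInduction with
    | self => exact ⟨_, .refl _, fun i h1 h2 => absurd h2 (not_lt.2 h1)⟩
    | @of_succ j hj ih =>
      obtain ⟨T, hT, hsub⟩ := ih
      refine ⟨_, .cons (hseg j hj) (h.1 j hj) (h.2 j hj).1 (h.2 j hj).2 hT, ?_⟩
      intro i h1 h2
      rcases eq_or_lt_of_le h1 with rfl | hlt
      · exact Set.subset_union_left
      · exact (hsub i hlt h2).trans Set.subset_union_right
  obtain ⟨T, hT, hsub⟩ := key 0 (Nat.zero_le n)
  exact ⟨T, hT, Set.iUnion₂_subset fun i hi => hsub i (Nat.zero_le i) (Finset.mem_range.1 hi)⟩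

-- **Statement 10.** (SLT for a staircase.) There is an absolute constant `C > 0` such
-- that for every `ε ∈ (0,1]` and every staircase path `L` contained in the vertical strip
-- `−1/2 ≤ x ≤ 1/2` with right (top) endpoint `(1/2, 0)`, there is a geometric graph
-- comprised of the edges of `L` and additional segments of total weight at most
-- `C·ε^{-1/2}` that contains, for every `t ∈ L`, a path from `s = (0, ε^{-1/2})` to `t`
-- of weight at most `(1 + C·ε)·|y(s) − y(t)| ≤ (1 + C·ε)·‖s − t‖`.
theorem slt_staircase_exists :
    ∃ C : ℝ, 0 < C ∧
      ∀ ε : ℝ, 0 < ε → ε ≤ 1 →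
      ∀ (n : ℕ) (u : ℕ → Plane),
        IsStaircase n u →
        (∀ p ∈ pathSet n u, -(1/2) ≤ p 0 ∧ p 0 ≤ 1/2) →
        u n = pt (1/2) 0 →
        ∃ Ex : Finset (Plane × Plane),
          gweight Ex ≤ C * (Real.sqrt ε)⁻¹ ∧
          ∀ t ∈ pathSet n u,
            HasPath (pathEdges n u ∪ Ex) (pt 0 (Real.sqrt ε)⁻¹) t
              ((1 + C * ε) * |(Real.sqrt ε)⁻¹ - t 1|) ∧
            (1 + C * ε) * |(Real.sqrt ε)⁻¹ - t 1| ≤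
              (1 + C * ε) * ‖pt 0 (Real.sqrt ε)⁻¹ - t‖ := by
  refine ⟨8, by norm_num, fun ε hε hε1 n u hu hstrip hun => ?_⟩
  have hε0 : 0 < Real.sqrt ε := Real.sqrt_pos.2 hε
  have hεh : ε * (Real.sqrt ε)⁻¹ = ((Real.sqrt ε)⁻¹)⁻¹ := by
    rw [inv_inv]
    nth_rewrite 1 [← Real.mul_self_sqrt hε.le]
    field_simp
  have hh : 1 ≤ (Real.sqrt ε)⁻¹ := (one_le_inv₀ hε0).2 (Real.sqrt_le_one.2 hε1)
  set h : ℝ := (Real.sqrt ε)⁻¹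
  obtain ⟨T, hT, hsub⟩ := hu.exists_stair
  have hwidth : u n 0 - u 0 0 ≤ 1 := by
    rcases Nat.eq_zero_or_pos n with rfl | hn
    · simp
    · have := (hstrip (u 0) (Set.mem_biUnion (Finset.mem_coe.2 (Finset.mem_range.2 hn))
        (left_mem_segment ℝ _ _))).1
      rw [hun, pt_zero]
      linarith
  obtain ⟨Ex, hwt, hpath⟩ := hT.exists_shallow_light ⌈h⌉₊ one_pos
    (show 0 < h / 2 by positivity) hwidth
  simp only [hun, pt_zero, pt_one, zero_add] at hpath
  have hroot : ‖pt (1 / 2) (h / 2) - pt 0 h‖ ≤ h / 2 + h⁻¹ := by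
    apply norm_sub_le_of_sq_le (by positivity)
    simp only [pt_zero, pt_one]
    have : h * h⁻¹ = 1 := mul_inv_cancel₀ (by positivity)
    nlinarith [sq_nonneg h⁻¹]
  have hinv : h⁻¹ ≤ 1 := inv_le_one_of_one_le₀ hh
  refine ⟨{(pt (1 / 2) (h / 2), pt 0 h)} ∪ Ex, ?_, fun t ht => ⟨?_, ?_⟩⟩
  · have h1 := gweight_union_le {(pt (1 / 2) (h / 2), pt 0 h)} Ex
    have h2 := (Nat.ceil_lt_add_one (show 0 ≤ h by positivity)).le
    rw [gweight_singleton] at h1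
    linarith
  · have ht1 : t 1 ≤ 0 := by simpa [hun] using (hT.coord_bounds (hsub ht)).2.2
    have hE : pathSet n u ⊆ segUnion (pathEdges n u ∪ ({(pt (1 / 2) (h / 2), pt 0 h)} ∪ Ex)) :=
      segUnion_pathEdges n u ▸ segUnion_mono Finset.subset_union_left
    have hstart := (HasPath.refl (pathEdges n u ∪ ({(pt (1 / 2) (h / 2), pt 0 h)} ∪ Ex))
      (pt 0 h)).snoc (b := pt (1 / 2) (h / 2)) (segment_subset_segUnion (by simp))
    refine (hpath _ hE (Finset.subset_union_right.trans Finset.subset_union_right) _ _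
      hstart t (hsub ht)).mono ?_
    have hpow : (1 : ℝ) / 2 ^ ⌈h⌉₊ ≤ h⁻¹ := by
      rw [one_div]
      apply inv_anti₀ (by positivity)
      calc h ≤ (⌈h⌉₊ : ℝ) := Nat.le_ceil h
        _ ≤ 2 ^ ⌈h⌉₊ := by exact_mod_cast Nat.lt_two_pow_self.le
    have hexc : 3 * (1 : ℝ) ^ 2 / (h / 2) = 6 * h⁻¹ := by field_simp; norm_num
    rw [abs_of_nonneg (by linarith), hexc]
    nlinarith [mul_nonneg hε.le (neg_nonneg.2 ht1)]
  · gcongr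
    simpa using PiLp.norm_apply_le (pt 0 h - t) 1

end
end
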